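/- arXiv:hep-th/0005110 — 6 statements merged into one kernel-verified Lean document; each statement's English description precedes it below -/
import Mathlib

section
/- Reverse Cauchy–Schwarz inequality in Minkowski space: if p and q are forward timelike vectors in ℝ⁴ (i.e. ⟪p,p⟫ > 0, p 0 > 0, ⟪q,q⟫ > 0, q 0 > 0), then ⟪p,q⟫ ≥ Real.sqrt (⟪p,p⟫ * ⟪q,q⟫), with equality if and only if p and q are linearly dependent over ℝ. -/
/-- Minkowski inner product on ℝ⁴. -/
def mink (p q : Fin 4 → ℝ) : ℝ := p 0 * q 0 - p 1 * q 1 - p 2 * q 2 - p 3 * q 3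

/-- The defect in the reverse Cauchy–Schwarz inequality as a sum of squares. -/
lemma two_mul_mink_sub_sqrt (p q : Fin 4 → ℝ) (hp : 0 ≤ mink p p) (hq : 0 ≤ mink q q) :
    2 * (p 0 * q 0) * (mink p q - √(mink p p * mink q q)) =
      (q 0 * √(mink p p) - p 0 * √(mink q q)) ^ 2 + (q 0 * p 1 - p 0 * q 1) ^ 2 +
        (q 0 * p 2 - p 0 * q 2) ^ 2 + (q 0 * p 3 - p 0 * q 3) ^ 2 := by
  rw [Real.sqrt_mul hp, sub_sq, mul_pow, mul_pow, Real.sq_sqrt hp, Real.sq_sqrt hq]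
  generalize √(mink p p) = a
  generalize √(mink q q) = b
  simp only [mink]
  ring

lemma mink_smul_right (a : ℝ) (p q : Fin 4 → ℝ) : mink p (a • q) = a * mink p q := by
  simp only [mink, Pi.smul_apply, smul_eq_mul]
  ring

lemma mink_smul_left (a : ℝ) (p q : Fin 4 → ℝ) : mink (a • p) q = a * mink p q := by
  simp only [mink, Pi.smul_apply, smul_eq_mul]
  ring

/-- Reverse Cauchy–Schwarz inequality for forward timelike vectors in Minkowski space,
with equality iff linear dependence. -/
theorem reverse_cauchy_schwarz_minkowski (p q : Fin 4 → ℝ)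
    (hp : 0 < mink p p) (hp0 : 0 < p 0)
    (hq : 0 < mink q q) (hq0 : 0 < q 0) :
    mink p q ≥ Real.sqrt (mink p p * mink q q) ∧
    (mink p q = Real.sqrt (mink p p * mink q q) ↔ ¬ LinearIndependent ℝ ![p, q]) := by
  have defect := two_mul_mink_sub_sqrt p q hp.le hq.le
  have hpq : 0 < 2 * (p 0 * q 0) := by positivity
  have hp_ne : p ≠ 0 := fun h => hp0.ne' (congrFun h 0)
  rw [LinearIndependent.pair_iff' hp_ne]
  push Not
  refine ⟨?_, fun h => ⟨q 0 / p 0, ?_⟩, ?_⟩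
  · refine sub_nonneg.mp (nonneg_of_mul_nonneg_right ?_ hpq)
    rw [defect]
    positivity
  · rw [h, sub_self, mul_zero] at defect
    have sq_time := sq_nonneg (q 0 * √(mink p p) - p 0 * √(mink q q))
    have sq_one := sq_nonneg (q 0 * p 1 - p 0 * q 1)
    have sq_two := sq_nonneg (q 0 * p 2 - p 0 * q 2)
    have sq_three := sq_nonneg (q 0 * p 3 - p 0 * q 3)
    ext i
    rw [Pi.smul_apply, smul_eq_mul, div_mul_eq_mul_div, div_eq_iff hp0.ne', mul_comm (q i),
      ← sub_eq_zero, ← sq_eq_zero_iff]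
    fin_cases i <;> simp only [Fin.zero_eta, Fin.mk_one, Fin.reduceFinMk]
    · ring
    all_goals linarith
  · rintro ⟨a, rfl⟩
    have ha : 0 < a := pos_of_mul_pos_left hq0 hp0.le
    have h_sq : mink p p * (a * (a * mink p p)) = (a * mink p p) ^ 2 := by ring
    rw [mink_smul_left, mink_smul_right, h_sq, Real.sqrt_sq (mul_pos ha hp).le]
end

section
/- The difference of two distinct vectors on the same forward mass shell is spacelike: if m > 0, p and q satisfy ⟪p,p⟫ = m^2, ⟪q,q⟫ = m^2, p 0 > 0 and q 0 > 0, then ⟪p - q, p - q⟫ ≤ 0, and ⟪p - q, p - q⟫ = 0 if and only if p = q. -/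
/-- For vectors of equal Minkowski square `c`, the Minkowski square of the difference, scaled by
the product of the time components, is minus a sum of squares weighted by `c` and `1`. -/
theorem mul_mink_sub_self {c : ℝ} {p q : Fin 4 → ℝ} (hp : mink p p = c) (hq : mink q q = c) :
    p 0 * q 0 * mink (p - q) (p - q) =
      -(c * (p 0 - q 0) ^ 2 + (q 0 * p 1 - p 0 * q 1) ^ 2 + (q 0 * p 2 - p 0 * q 2) ^ 2 +
        (q 0 * p 3 - p 0 * q 3) ^ 2) := by
  simp only [mink, Pi.sub_apply] at *
  linear_combination (p 0 * q 0 - q 0 ^ 2) * hp + (p 0 * q 0 - p 0 ^ 2) * hq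

/-- The difference of two vectors on the same forward mass shell of mass m > 0 is
spacelike, and lightlike (zero Minkowski square) iff the vectors coincide. -/
theorem massShell_diff_spacelike (m : ℝ) (hm : 0 < m) (p q : Fin 4 → ℝ)
    (hp : mink p p = m ^ 2) (hq : mink q q = m ^ 2)
    (hp0 : 0 < p 0) (hq0 : 0 < q 0) :
    mink (p - q) (p - q) ≤ 0 ∧ (mink (p - q) (p - q) = 0 ↔ p = q) := by
  have key := mul_mink_sub_self hp hq
  have hpq : 0 < p 0 * q 0 := mul_pos hp0 hq0
  refine ⟨nonpos_of_mul_nonpos_right (key.trans_le (neg_nonpos.2 (by positivity))) hpq,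
    fun h => ?_, fun h => by simp [h, mink]⟩
  rw [h, mul_zero] at key
  have h₀ : 0 ≤ m ^ 2 * (p 0 - q 0) ^ 2 := by positivity
  have h₁ := sq_nonneg (q 0 * p 1 - p 0 * q 1)
  have h₂ := sq_nonneg (q 0 * p 2 - p 0 * q 2)
  have h₃ := sq_nonneg (q 0 * p 3 - p 0 * q 3)
  have time_eq : p 0 = q 0 := by
    have : m ^ 2 * (p 0 - q 0) ^ 2 = 0 := by linarith
    simpa [hm.ne', sub_eq_zero] using this
  have space_eq {x y : ℝ} (hxy : (q 0 * x - p 0 * y) ^ 2 = 0) : x = y := by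
    rw [time_eq, ← mul_sub] at hxy
    simpa [hq0.ne', sub_eq_zero] using hxy
  have x_eq : p 1 = q 1 := space_eq (by linarith)
  have y_eq : p 2 = q 2 := space_eq (by linarith)
  have z_eq : p 3 = q 3 := space_eq (by linarith)
  ext i
  fin_cases i <;> assumption
end

section
/- The difference of two forward lightlike vectors is spacelike or lightlike, and lightlike only for parallel vectors: if p and q satisfy ⟪p,p⟫ = 0, p ≠ 0, p 0 > 0 and ⟪q,q⟫ = 0, q ≠ 0, q 0 > 0, then ⟪p - q, p - q⟫ ≤ 0, and ⟪p - q, p - q⟫ = 0 if and only if there exists λ > 0 with q = λ • p. -/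
/-- For lightlike `p`, `q`, the Minkowski square of `p - q` is, up to the factor `-(p 0 * q 0)`,
the sum of squares of the mixed minors of `p` and `q`. -/
theorem mul_mink_sub_self_of_lightlike {p q : Fin 4 → ℝ} (hp : mink p p = 0) (hq : mink q q = 0) :
    p 0 * q 0 * mink (p - q) (p - q) =
      -((q 0 * p 1 - p 0 * q 1) ^ 2 + (q 0 * p 2 - p 0 * q 2) ^ 2
        + (q 0 * p 3 - p 0 * q 3) ^ 2) := by
  simp only [mink, Pi.sub_apply] at *
  linear_combination (p 0 * q 0 - q 0 ^ 2) * hp + (p 0 * q 0 - p 0 ^ 2) * hq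

/-- The difference of two forward lightlike vectors is spacelike or lightlike, and
lightlike exactly when the two vectors are positively parallel. -/
theorem lightlike_diff_spacelike_or_parallel (p q : Fin 4 → ℝ)
    (hp : mink p p = 0) (hpne : p ≠ 0) (hp0 : 0 < p 0)
    (hq : mink q q = 0) (hqne : q ≠ 0) (hq0 : 0 < q 0) :
    mink (p - q) (p - q) ≤ 0 ∧
    (mink (p - q) (p - q) = 0 ↔ ∃ l : ℝ, 0 < l ∧ q = l • p) := by
  have key := mul_mink_sub_self_of_lightlike hp hq
  have hpos : 0 < p 0 * q 0 := mul_pos hp0 hq0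
  refine ⟨nonpos_of_mul_nonpos_right (key.trans_le (neg_nonpos.2 (by positivity))) hpos, ?_, ?_⟩
  · intro h
    rw [h, mul_zero] at key
    have h1 : q 0 * p 1 - p 0 * q 1 = 0 := by
      rw [← sq_eq_zero_iff]
      nlinarith
    have h2 : q 0 * p 2 - p 0 * q 2 = 0 := by
      rw [← sq_eq_zero_iff]
      nlinarith
    have h3 : q 0 * p 3 - p 0 * q 3 = 0 := by
      rw [← sq_eq_zero_iff]
      nlinarith
    refine ⟨q 0 / p 0, div_pos hq0 hp0, ?_⟩
    ext i
    rw [Pi.smul_apply, smul_eq_mul, div_mul_eq_mul_div, eq_div_iff hp0.ne']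
    fin_cases i <;> simp only [Fin.zero_eta, Fin.mk_one, Fin.reduceFinMk] <;> linarith
  · rintro ⟨l, -, rfl⟩
    simp only [mink, Pi.sub_apply, Pi.smul_apply, smul_eq_mul] at *
    linear_combination (1 - l) ^ 2 * hp
end

section
/- On the forward tube the complexified Minkowski square avoids the nonnegative reals: if x ∈ ℝ⁴, η is forward timelike (⟪η,η⟫ > 0, η 0 > 0), and z : Fin 4 → ℂ is defined by z μ = (x μ : ℂ) - Complex.I * (η μ), then the complexified Minkowski square Q z = (z 0)^2 - (z 1)^2 - (z 2)^2 - (z 3)^2 satisfies: there is no t : ℝ with 0 ≤ t and Q z = (t : ℂ). Equivalently, -Q z lies in ℂ \ (Set.Iic (0:ℝ) mapped into ℂ), the domain of analyticity of the principal branch of complex powers. -/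
/-- Complexified Minkowski square. -/
def Qc (z : Fin 4 → ℂ) : ℂ := (z 0) ^ 2 - (z 1) ^ 2 - (z 2) ^ 2 - (z 3) ^ 2

/-- A vector Minkowski-orthogonal to a timelike vector is not timelike. -/
theorem mink_self_nonpos_of_mink_eq_zero {x η : Fin 4 → ℝ} (hη : 0 < mink η η)
    (h : mink x η = 0) : mink x x ≤ 0 := by
  unfold mink at *
  by_contra! hx
  have cauchy_schwarz : (x 1 * η 1 + x 2 * η 2 + x 3 * η 3) ^ 2 ≤
      (x 1 ^ 2 + x 2 ^ 2 + x 3 ^ 2) * (η 1 ^ 2 + η 2 ^ 2 + η 3 ^ 2) := by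
    nlinarith [sq_nonneg (x 1 * η 2 - x 2 * η 1), sq_nonneg (x 1 * η 3 - x 3 * η 1),
      sq_nonneg (x 2 * η 3 - x 3 * η 2)]
  have time_eq : x 1 * η 1 + x 2 * η 2 + x 3 * η 3 = x 0 * η 0 := by linarith
  have lt : (x 1 ^ 2 + x 2 ^ 2 + x 3 ^ 2) * (η 1 ^ 2 + η 2 ^ 2 + η 3 ^ 2) <
      x 0 ^ 2 * η 0 ^ 2 :=
    mul_lt_mul'' (by linarith) (by linarith) (by positivity) (by positivity)
  rw [time_eq, mul_pow] at cauchy_schwarz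
  exact absurd cauchy_schwarz lt.not_ge

/-- The complexified Minkowski square in terms of real and imaginary parts. -/
theorem Qc_sub_I_mul (x η : Fin 4 → ℝ) :
    Qc (fun μ => (x μ : ℂ) - Complex.I * (η μ : ℂ)) =
      ((mink x x - mink η η : ℝ) : ℂ) - ((2 * mink x η : ℝ) : ℂ) * Complex.I := by
  unfold Qc mink
  push_cast
  linear_combination
    ((η 0 : ℂ) ^ 2 - (η 1 : ℂ) ^ 2 - (η 2 : ℂ) ^ 2 - (η 3 : ℂ) ^ 2) * Complex.I_sq

/-- On the forward tube the complexified Minkowski square avoids the nonnegative reals;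
equivalently, its negative avoids the image of `Set.Iic 0` in ℂ. -/
theorem forwardTube_square_avoids_nonneg_reals (x η : Fin 4 → ℝ)
    (hη : 0 < mink η η) (hη0 : 0 < η 0)
    (z : Fin 4 → ℂ) (hz : ∀ μ, z μ = (x μ : ℂ) - Complex.I * (η μ : ℂ)) :
    (¬ ∃ t : ℝ, 0 ≤ t ∧ Qc z = (t : ℂ)) ∧
    -Qc z ∉ (fun t : ℝ => (t : ℂ)) '' Set.Iic (0 : ℝ) := by
  have avoids : ¬ ∃ t : ℝ, 0 ≤ t ∧ Qc z = (t : ℂ) := by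
    rintro ⟨t, ht, hQ⟩
    rw [funext hz, Qc_sub_I_mul] at hQ
    have hre : mink x x - mink η η = t := by simpa using congrArg Complex.re hQ
    have him : mink x η = 0 := by simpa using congrArg Complex.im hQ
    linarith [mink_self_nonpos_of_mink_eq_zero hη him]
  refine ⟨avoids, ?_⟩
  rintro ⟨t, ht, hQ⟩
  refine avoids ⟨-t, neg_nonneg.mpr ht, ?_⟩
  rw [Complex.ofReal_neg]
  exact neg_eq_iff_eq_neg.mp hQ.symm
end

section
/- Analyticity of the conformal two-point function of dimension d on the forward tube: for every d : ℂ, the function z ↦ (-(Q z)) ^ (-d) (complex power via Complex.cpow with Q z = (z 0)^2 - (z 1)^2 - (z 2)^2 - (z 3)^2) is differentiable over ℂ (i.e. DifferentiableOn ℂ) on the forward tube T = { z : Fin 4 → ℂ | ∃ (x η : Fin 4 → ℝ), ⟪η,η⟫ > 0 ∧ η 0 > 0 ∧ ∀ μ, z μ = (x μ : ℂ) - Complex.I * (η μ) }. -/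
/-- The forward tube: all z = x - iη with x real and η in the open forward light cone. -/
def forwardTube : Set (Fin 4 → ℂ) :=
  { z | ∃ x η : Fin 4 → ℝ, 0 < mink η η ∧ 0 < η 0 ∧
      ∀ μ, z μ = (x μ : ℂ) - Complex.I * (η μ : ℂ) }

theorem neg_Qc_mem_slitPlane {z : Fin 4 → ℂ} (hz : z ∈ forwardTube) :
    -(Qc z) ∈ Complex.slitPlane := by
  obtain ⟨x, η, hη, -, hz⟩ := hz
  have hre : (-(Qc z)).re = mink η η - mink x x := by
    simp [Qc, hz, mink, pow_two]
    ring
  have him : (-(Qc z)).im = 2 * mink x η := by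
    simp [Qc, hz, mink, pow_two]
    ring
  rw [Complex.mem_slitPlane_iff, hre, him]
  by_cases h : mink x η = 0
  · left
    linarith [mink_self_nonpos_of_mink_eq_zero hη h]
  · right
    simpa using h

/-- The conformal two-point function of scale dimension d is holomorphic on the
forward tube. -/
theorem conformal_two_point_analytic (d : ℂ) :
    DifferentiableOn ℂ (fun z : Fin 4 → ℂ => (-(Qc z)) ^ (-d)) forwardTube := by
  refine DifferentiableOn.cpow_const ?_ fun z hz => neg_Qc_mem_slitPlane hz
  unfold Qc
  fun_prop
end

section
/- Boundary uniqueness for analytic functions (one-variable form of the generalized Schwarz reflection principle used in the Jost–Schroer argument): let f : ℂ → ℂ be continuous on the closed upper half-plane { z | 0 ≤ z.im } and differentiable over ℂ on the open upper half-plane { z | 0 < z.im }. If there exist real numbers a < b such that f (t : ℂ) = 0 for all t ∈ Set.Ioo a b, then f z = 0 for all z in the closed upper half-plane. -/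
/-- If `f` is continuous on the closed upper half-plane, holomorphic inside and zero on the real
segment of half-length `δ` around `m`, then the product of the four rotations of `f` about
`m + δ * I` by multiples of a right angle vanishes on the square of half-side `δ`. -/
theorem prod_rotations_eq_zero_on_square {f : ℂ → ℂ}
    (hc : ContinuousOn f { z : ℂ | 0 ≤ z.im })
    (hd : DifferentiableOn ℂ f { z : ℂ | 0 < z.im })
    {m δ : ℝ} (hδ : 0 < δ) (hv : ∀ t : ℝ, |t - m| ≤ δ → f (t : ℂ) = 0) :
    ∀ ζ ∈ Set.Ioo (-δ) δ ×ℂ Set.Ioo (-δ) δ,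
      f (m + δ * Complex.I + ζ) * f (m + δ * Complex.I + Complex.I * ζ) *
        f (m + δ * Complex.I + -ζ) * f (m + δ * Complex.I + -(Complex.I * ζ)) = 0 := by
  have hne : -δ ≠ δ := by linarith
  have hcl : closure (Set.Ioo (-δ) δ ×ℂ Set.Ioo (-δ) δ) = Set.Icc (-δ) δ ×ℂ Set.Icc (-δ) δ := by
    rw [Complex.closure_reProdIm, closure_Ioo hne]
  have hdc : ∀ φ : ℂ → ℂ, Differentiable ℂ φ →
      (∀ ζ, |(φ ζ).im| = |ζ.im| ∨ |(φ ζ).im| = |ζ.re|) →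
      DiffContOnCl ℂ (fun ζ => f (m + δ * Complex.I + φ ζ))
        (Set.Ioo (-δ) δ ×ℂ Set.Ioo (-δ) δ) := by
    intro φ hφ him
    have hφ' : Differentiable ℂ fun ζ => m + δ * Complex.I + φ ζ := by fun_prop
    refine ⟨hd.comp hφ'.differentiableOn fun ζ hζ => ?_, ?_⟩
    · simp only [Complex.mem_reProdIm, Set.mem_Ioo, ← abs_lt] at hζ
      have : |(φ ζ).im| < δ := by rcases him ζ with h | h <;> rw [h] <;> tauto
      simpa using by linarith [(abs_lt.1 this).1]
    · rw [hcl]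
      refine hc.comp hφ'.continuous.continuousOn fun ζ hζ => ?_
      simp only [Complex.mem_reProdIm, Set.mem_Icc, ← abs_le] at hζ
      have : |(φ ζ).im| ≤ δ := by rcases him ζ with h | h <;> rw [h] <;> tauto
      simpa using by linarith [(abs_le.1 this).1]
  have hF := (((hdc (fun ζ => ζ) (by fun_prop) (by simp)).smul
    (hdc (fun ζ => Complex.I * ζ) (by fun_prop) (by simp))).smul
    (hdc (fun ζ => -ζ) (by fun_prop) (by simp))).smul
    (hdc (fun ζ => -(Complex.I * ζ)) (by fun_prop) (by simp))
  have hbdd : Bornology.IsBounded (Set.Ioo (-δ) δ ×ℂ Set.Ioo (-δ) δ) :=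
    (Metric.isBounded_Ioo _ _).reProdIm (Metric.isBounded_Ioo _ _)
  have hzero : ∀ w : ℂ, w.im = -δ → |w.re| ≤ δ → f (m + δ * Complex.I + w) = 0 := by
    intro w him hre
    have : (m + δ * Complex.I + w : ℂ) = ((m + w.re : ℝ) : ℂ) := by
      apply Complex.ext <;> simp [him]
    rw [this]
    exact hv _ (by simpa using hre)
  refine Complex.eqOn_of_eqOn_frontier (g := fun _ => 0) hbdd hF diffContOnCl_const ?_
  intro ζ hζ
  have hζcl := hζ.1
  have hζint := hζ.2
  rw [hcl, Complex.mem_reProdIm, Set.mem_Icc, Set.mem_Icc, ← abs_le, ← abs_le] at hζcl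
  rw [(isOpen_Ioo.reProdIm isOpen_Ioo).interior_eq, Complex.mem_reProdIm, Set.mem_Ioo, Set.mem_Ioo,
    ← abs_lt, ← abs_lt, not_and_or, not_lt, not_lt] at hζint
  obtain ⟨hre, him⟩ := hζcl
  simp only [mul_eq_zero]
  rcases hζint with h | h
  · rcases abs_eq hδ.le |>.1 (le_antisymm hre h) with h | h
    · exact Or.inr (hzero _ (by simp [h]) (by simpa using him))
    · exact Or.inl (Or.inl (Or.inr (hzero _ (by simp [h]) (by simpa using him))))
  · rcases abs_eq hδ.le |>.1 (le_antisymm him h) with h | h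
    · exact Or.inl (Or.inr (hzero _ (by simp [h]) (by simpa using hre)))
    · exact Or.inl (Or.inl (Or.inl (hzero _ (by simp [h]) (by simpa using hre))))

/-- Boundary uniqueness for analytic functions on the upper half-plane: a function
continuous on the closed upper half-plane, holomorphic on the open upper half-plane,
which vanishes on an open real interval of the boundary, vanishes identically. -/
theorem boundary_uniqueness_upper_half_plane (f : ℂ → ℂ)
    (hc : ContinuousOn f { z : ℂ | 0 ≤ z.im })
    (hd : DifferentiableOn ℂ f { z : ℂ | 0 < z.im })
    (a b : ℝ) (hab : a < b)
    (hv : ∀ t ∈ Set.Ioo a b, f (t : ℂ) = 0) :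
    ∀ z ∈ { z : ℂ | 0 ≤ z.im }, f z = 0 := by
  obtain ⟨m, δ, hδ, hmδ⟩ : ∃ m δ : ℝ, 0 < δ ∧ ∀ t : ℝ, |t - m| ≤ δ → f (t : ℂ) = 0 := by
    refine ⟨(a + b) / 2, (b - a) / 4, by linarith, fun t ht => hv t ?_⟩
    rw [abs_le] at ht
    constructor <;> linarith
  have hprod := prod_rotations_eq_zero_on_square hc hd hδ hmδ
  set p : ℂ := m + δ * Complex.I with hp
  have hopen : IsOpen { z : ℂ | 0 < z.im } := isOpen_lt continuous_const Complex.continuous_im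
  have han : AnalyticOnNhd ℂ f { z : ℂ | 0 < z.im } := hd.analyticOnNhd hopen
  have hpU : p ∈ { z : ℂ | 0 < z.im } := by simpa [hp] using hδ
  have hev : ∀ᶠ z in nhds p, f z = 0 := by
    refine (han p hpU).eventually_eq_zero_or_eventually_ne_zero.resolve_right fun hne => ?_
    have hrot : ∀ c : ℂ, c ≠ 0 → ∀ᶠ ζ in nhdsWithin 0 {0}ᶜ, f (p + c * ζ) ≠ 0 := by
      intro c hc0
      refine Filter.Tendsto.eventually (f := fun ζ => p + c * ζ) (tendsto_nhdsWithin_iff.2 ⟨?_, ?_⟩) hne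
      · have : Continuous fun ζ : ℂ => p + c * ζ := by fun_prop
        simpa using (this.tendsto 0).mono_left nhdsWithin_le_nhds
      · filter_upwards [self_mem_nhdsWithin] with ζ hζ
        simpa [hc0] using hζ
    have hsq : ∀ᶠ ζ in nhdsWithin (0 : ℂ) {0}ᶜ, ζ ∈ Set.Ioo (-δ) δ ×ℂ Set.Ioo (-δ) δ :=
      nhdsWithin_le_nhds ((isOpen_Ioo.reProdIm isOpen_Ioo).mem_nhds
        (by simp [Complex.mem_reProdIm, hδ]))
    obtain ⟨ζ, hζ, h₁, h₂, h₃, h₄⟩ := (hsq.and <| (hrot 1 one_ne_zero).and <|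
      (hrot Complex.I Complex.I_ne_zero).and <| (hrot (-1) (by simp)).and <|
      hrot (-Complex.I) (by simp)).exists
    simp only [one_mul, neg_mul] at h₁ h₂ h₃ h₄
    exact mul_ne_zero (mul_ne_zero (mul_ne_zero h₁ h₂) h₃) h₄ (hprod ζ hζ)
  have hzero : Set.EqOn f 0 { z : ℂ | 0 < z.im } :=
    han.eqOn_zero_of_preconnected_of_eventuallyEq_zero
      (convex_halfSpace_im_gt 0).isPreconnected hpU hev
  exact hzero.of_subset_closure hc continuousOn_const (fun z (hz : 0 < z.im) => hz.le)
    (Complex.closure_setOfPred_lt_im 0).ge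
end
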